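/- arXiv:1510.02553 — 2 statements merged into one kernel-verified Lean document; each statement's English description precedes it below -/
import Mathlib

section
/- Let F be any field. The commutator (derived) subgroup of GSpin₆(F) = {(g, A) ∈ Fˣ × GL₄(F) : g² = det A} is exactly {(1, A) : A ∈ SL₄(F)}, i.e., it is isomorphic to SL₄(F). -/
/-!
STATEMENT 5: For any field F, the commutator (derived) subgroup of
GSpin₆(F) = {(g, A) ∈ Fˣ × GL₄(F) : g² = det A} is exactly {(1, A) : A ∈ SL₄(F)},
i.e., it is isomorphic to SL₄(F).
-/

open Matrix

variable (F : Type*) [Field F]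

/-- The F-points of the split general spin group `GSpin₆`. -/
def GSpin6 : Subgroup (Fˣ × GL (Fin 4) F) where
  carrier := {p | p.1 ^ 2 = Matrix.GeneralLinearGroup.det p.2}
  one_mem' := by
    show (1 : Fˣ) ^ 2 = Matrix.GeneralLinearGroup.det (1 : GL (Fin 4) F)
    rw [one_pow, MonoidHom.map_one]
  mul_mem' := by
    intro a b ha hb
    simp only [Set.mem_setOf_eq, Prod.fst_mul, Prod.snd_mul] at *
    rw [mul_pow, MonoidHom.map_mul, ha, hb]
  inv_mem' := by
    intro a ha
    simp only [Set.mem_setOf_eq, Prod.fst_inv, Prod.snd_inv] at *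
    rw [inv_pow, MonoidHom.map_inv, ha]

/-- The copy of `{1} × SL₄(F)` inside `GSpin₆(F)`. -/
def OnexSL4 : Subgroup (GSpin6 F) where
  carrier := {p | (p : Fˣ × GL (Fin 4) F).1 = 1 ∧
    Matrix.GeneralLinearGroup.det (p : Fˣ × GL (Fin 4) F).2 = 1}
  one_mem' := by
    constructor <;>
      simp only [Subgroup.coe_one, Prod.fst_one, Prod.snd_one, MonoidHom.map_one]
  mul_mem' := by
    intro a b ha hb
    obtain ⟨ha1, ha2⟩ := ha
    obtain ⟨hb1, hb2⟩ := hb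
    constructor
    · rw [Subgroup.coe_mul, Prod.fst_mul, ha1, hb1, mul_one]
    · rw [Subgroup.coe_mul, Prod.snd_mul, MonoidHom.map_mul, ha2, hb2, mul_one]
  inv_mem' := by
    intro a ha
    obtain ⟨ha1, ha2⟩ := ha
    constructor
    · rw [Subgroup.coe_inv, Prod.fst_inv, ha1, inv_one]
    · rw [Subgroup.coe_inv, Prod.snd_inv, MonoidHom.map_inv, ha2, inv_one]

namespace Matrix.SpecialLinearGroup

open scoped commutatorElement

variable {ι K : Type*} [Fintype ι] [DecidableEq ι] [Field K]

lemma commutator_transvection_transvection {i j k : ι} (hik : i ≠ k) (hkj : k ≠ j) (hij : i ≠ j)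
    (c d : K) :
    ⁅(transvection hik c : SpecialLinearGroup ι K), transvection hkj d⁆ =
      transvection hij (c * d) := by
  rw [commutatorElement_def, mul_inv_eq_iff_eq_mul, mul_inv_eq_iff_eq_mul]
  refine Subtype.ext ?_
  simp [transvection_coe, Matrix.add_mul, Matrix.mul_add, hkj.symm, hij.symm]
  abel

lemma diag2n_eq_prod_transvection {i j : ι} (hij : i ≠ j) (a : K) (ha : a ≠ 0) :
    diag2n hij a ha = transvection hij a * (transvection hij.symm (-a⁻¹) *
      (transvection hij a * (transvection hij (-1) *
        (transvection hij.symm 1 * transvection hij (-1))))) := by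
  refine Subtype.ext (Matrix.ext fun p q => ?_)
  have key (x y : ι) (h : x ≠ y) (c : K) :
      ((transvection h c : SpecialLinearGroup ι K) : Matrix ι ι K) = Matrix.transvection x y c :=
    rfl
  simp only [coe_mul, key, diag2n_coe]
  by_cases hpi : p = i
  · subst hpi
    simp [hij, hij.symm, diagonal_apply]
    simp [Matrix.transvection, one_apply, single_apply]
    grind
  by_cases hpj : p = j
  · subst hpj
    simp [hij, hij.symm, diagonal_apply]
    simp [Matrix.transvection, one_apply, single_apply]
    grind
  simp [hpi, hpj, diagonal_apply]
  simp [Matrix.transvection, one_apply, Ne.symm hpi]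

/-- `SLₙ` over a field is perfect for `n ≥ 3`. -/
theorem commutator_eq_top (hι : 2 < Fintype.card ι) :
    commutator (SpecialLinearGroup ι K) = ⊤ := by
  have : Nontrivial ι := Fintype.one_lt_card_iff_nontrivial.mp (by omega)
  have htrans (i j : ι) (hij : i ≠ j) (c : K) :
      transvection hij c ∈ commutator (SpecialLinearGroup ι K) := by
    obtain ⟨k, hk⟩ : ∃ k, k ∉ ({i, j} : Finset ι) := by
      by_contra! h
      have := Finset.card_le_card (fun x _ => h x : Finset.univ ⊆ ({i, j} : Finset ι))
      have := Finset.card_le_two (a := i) (b := j)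
      rw [Finset.card_univ] at *
      omega
    simp only [Finset.mem_insert, Finset.mem_singleton, not_or] at hk
    rw [← mul_one c, ← commutator_transvection_transvection (Ne.symm hk.1) hk.2 hij]
    exact Subgroup.commutator_mem_commutator (Subgroup.mem_top _) (Subgroup.mem_top _)
  refine eq_top_iff.mpr fun A _ => diagonal_transvection_induction' _ A
    (fun i j hij c hc => ?_) htrans fun _ _ => mul_mem
  rw [diag2n_eq_prod_transvection]
  exact mul_mem (htrans _ _ _ _) (mul_mem (htrans _ _ _ _) (mul_mem (htrans _ _ _ _)
    (mul_mem (htrans _ _ _ _) (mul_mem (htrans _ _ _ _) (htrans _ _ _ _)))))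

end Matrix.SpecialLinearGroup

/-- The embedding `A ↦ (1, A)` of `SL₄(F)` into `GSpin₆(F)`. -/
def specialLinearToGSpin6 : SpecialLinearGroup (Fin 4) F →* GSpin6 F :=
  (MonoidHom.prod 1 SpecialLinearGroup.toGL).codRestrict (GSpin6 F) fun A => by
    show (1 : Fˣ) ^ 2 = GeneralLinearGroup.det (SpecialLinearGroup.toGL A)
    rw [one_pow, SpecialLinearGroup.coeToGL_det]

lemma specialLinearToGSpin6_injective : Function.Injective (specialLinearToGSpin6 F) :=
  fun _ _ h => SpecialLinearGroup.toGL_injective (congrArg (fun p => p.1.2) h)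

lemma range_specialLinearToGSpin6 : (specialLinearToGSpin6 F).range = OnexSL4 F := by
  ext p
  constructor
  · rintro ⟨A, rfl⟩
    exact ⟨rfl, SpecialLinearGroup.coeToGL_det A⟩
  · rintro ⟨h₁, h₂⟩
    exact ⟨⟨p.1.2, congrArg Units.val h₂⟩,
      Subtype.ext (Prod.ext h₁.symm (Units.ext rfl))⟩

lemma commutator_GSpin6_le : commutator (GSpin6 F) ≤ OnexSL4 F := by
  refine Subgroup.commutator_le.mpr fun a _ b _ => ⟨?_, ?_⟩
  · exact (map_commutatorElement ((MonoidHom.fst _ _).comp (GSpin6 F).subtype) a b).trans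
      (commutatorElement_eq_one_iff_mul_comm.mpr (mul_comm _ _))
  · exact (map_commutatorElement
      (GeneralLinearGroup.det.comp ((MonoidHom.snd _ _).comp (GSpin6 F).subtype)) a b).trans
      (commutatorElement_eq_one_iff_mul_comm.mpr (mul_comm _ _))

lemma OnexSL4_le_commutator : OnexSL4 F ≤ commutator (GSpin6 F) := by
  rw [← range_specialLinearToGSpin6, MonoidHom.range_eq_map,
    ← SpecialLinearGroup.commutator_eq_top (by simp), commutator_def, Subgroup.map_commutator]
  exact Subgroup.commutator_mono le_top le_top

theorem statement5 :
    commutator (GSpin6 F) = OnexSL4 F ∧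
    Nonempty (OnexSL4 F ≃* Matrix.SpecialLinearGroup (Fin 4) F) := by
  exact ⟨le_antisymm (commutator_GSpin6_le F) (OnexSL4_le_commutator F),
    ⟨((MonoidHom.ofInjective (specialLinearToGSpin6_injective F)).trans
      (MulEquiv.subgroupCongr (range_specialLinearToGSpin6 F))).symm⟩⟩
end

section
/- Let F be a field and let σ₁, σ₂ be irreducible representations of GL₂(F) on nonzero complex vector spaces V₁, V₂. For a group homomorphism χ : Fˣ → ℂˣ, write σᵢχ for the twisted representation g ↦ χ(det g)·σᵢ(g), and set I^{SL₂}(σᵢ) = {χ : Fˣ → ℂˣ : σᵢχ ≅ σᵢ}. Then the set I^{GSpin₄}(σ₁ ⊠ σ₂) := {χ : Fˣ → ℂˣ : (σ₁χ) ⊠ (σ₂χ⁻¹) ≅ σ₁ ⊠ σ₂ as representations of GL₂(F) × GL₂(F)} equals I^{SL₂}(σ₁) ∩ I^{SL₂}(σ₂). Moreover, if σ₂ ≅ σ₁η for some homomorphism η : Fˣ → ℂˣ, then I^{GSpin₄}(σ₁ ⊠ σ₂) = I^{SL₂}(σ₁). -/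
/-!
STATEMENT 9: For irreducible representations σ₁, σ₂ of GL₂(F) and characters
χ : Fˣ → ℂˣ, the group I^{GSpin₄}(σ₁ ⊠ σ₂) = {χ : (σ₁χ) ⊠ (σ₂χ⁻¹) ≅ σ₁ ⊠ σ₂} equals
I^{SL₂}(σ₁) ∩ I^{SL₂}(σ₂); and if σ₂ ≅ σ₁η for some character η then it equals
I^{SL₂}(σ₁).
-/

open Matrix TensorProduct

noncomputable section

/-- Irreducibility of a representation: the space is nonzero and the only invariant
subspaces are 0 and the whole space. -/
def RepIrreducible {k G V : Type*} [CommRing k] [Group G] [AddCommGroup V] [Module k V]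
    (ρ : Representation k G V) : Prop :=
  (∃ v : V, v ≠ 0) ∧
    ∀ p : Submodule k V, (∀ (g : G) (v : V), v ∈ p → ρ g v ∈ p) → p = ⊥ ∨ p = ⊤

/-- Isomorphism of representations: an equivariant linear isomorphism. -/
def RepIso {k G V W : Type*} [CommRing k] [Group G] [AddCommGroup V] [Module k V]
    [AddCommGroup W] [Module k W]
    (ρ : Representation k G V) (τ : Representation k G W) : Prop :=
  ∃ e : V ≃ₗ[k] W, ∀ (g : G) (v : V), e (ρ g v) = τ g (e v)

/-- External tensor product of representations of two groups. -/
def extProd {k G H V W : Type*} [CommRing k] [Group G] [Group H] [AddCommGroup V]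
    [Module k V] [AddCommGroup W] [Module k W]
    (ρ : Representation k G V) (τ : Representation k H W) :
    Representation k (G × H) (V ⊗[k] W) :=
  Representation.tprod (ρ.comp (MonoidHom.fst G H)) (τ.comp (MonoidHom.snd G H))

/-- The twist of a representation of GLₙ(F) by a character χ of Fˣ:
`g ↦ χ(det g) • σ(g)`. -/
def twistGL {n : ℕ} {F V : Type*} [Field F] [AddCommGroup V] [Module ℂ V]
    (σ : Representation ℂ (GL (Fin n) F) V) (χ : Fˣ →* ℂˣ) :
    Representation ℂ (GL (Fin n) F) V where
  toFun g := ((χ (Matrix.GeneralLinearGroup.det g) : ℂˣ) : ℂ) • σ g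
  map_one' := by simp
  map_mul' g h := by
    simp only [MonoidHom.map_mul, Units.val_mul, smul_mul_smul_comm]

/-- Contraction against a linear functional on the second factor. -/
def contractSnd {k V W : Type*} [CommRing k] [AddCommGroup V] [Module k V]
    [AddCommGroup W] [Module k W] (f : W →ₗ[k] k) : V ⊗[k] W →ₗ[k] V :=
  (TensorProduct.rid k V).toLinearMap ∘ₗ f.lTensor V

theorem contractSnd_tmul {k V W : Type*} [CommRing k] [AddCommGroup V] [Module k V]
    [AddCommGroup W] [Module k W] (f : W →ₗ[k] k) (v : V) (w : W) :
    contractSnd f (v ⊗ₜ[k] w) = f w • v := by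
  simp [contractSnd]

theorem eq_zero_of_contractSnd_eq_zero {k V W : Type*} [Field k] [AddCommGroup V] [Module k V]
    [AddCommGroup W] [Module k W] (x : V ⊗[k] W)
    (h : ∀ f : W →ₗ[k] k, contractSnd f x = 0) : x = 0 := by
  classical
  let b := Module.Basis.ofVectorSpace k W
  apply (TensorProduct.equivFinsuppOfBasisRight (M := V) b).injective
  rw [map_zero]
  ext i
  rw [TensorProduct.equivFinsuppOfBasisRight_apply]
  exact h (b.coord i)

section RepIso

variable {k G H V V' W W' X : Type*} [Group G] [Group H]

theorem RepIso.symm [CommRing k] [AddCommGroup V] [Module k V] [AddCommGroup W] [Module k W]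
    {ρ : Representation k G V} {τ : Representation k G W} (h : RepIso ρ τ) : RepIso τ ρ := by
  obtain ⟨e, he⟩ := h
  exact ⟨e.symm, fun g v => e.injective (by simp [he])⟩

theorem RepIso.trans [CommRing k] [AddCommGroup V] [Module k V] [AddCommGroup W] [Module k W]
    [AddCommGroup X] [Module k X] {ρ : Representation k G V} {τ : Representation k G W}
    {π : Representation k G X} (h : RepIso ρ τ) (h' : RepIso τ π) : RepIso ρ π := by
  obtain ⟨e, he⟩ := h
  obtain ⟨e', he'⟩ := h'
  exact ⟨e.trans e', fun g v => by simp [he, he']⟩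

theorem extProd_apply_tmul [CommRing k] [AddCommGroup V] [Module k V] [AddCommGroup W]
    [Module k W] (ρ : Representation k G V) (τ : Representation k H W) (g : G) (h : H)
    (v : V) (w : W) : extProd ρ τ (g, h) (v ⊗ₜ[k] w) = ρ g v ⊗ₜ[k] τ h w := by
  simp [extProd]

theorem RepIso.extProd_congr [CommRing k] [AddCommGroup V] [Module k V] [AddCommGroup W]
    [Module k W] [AddCommGroup V'] [Module k V'] [AddCommGroup W'] [Module k W']
    {ρ : Representation k G V} {ρ' : Representation k G V'} {τ : Representation k H W}
    {τ' : Representation k H W'} (h : RepIso ρ ρ') (h' : RepIso τ τ') :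
    RepIso (extProd ρ τ) (extProd ρ' τ') := by
  obtain ⟨e, he⟩ := h
  obtain ⟨e', he'⟩ := h'
  refine ⟨TensorProduct.congr e e', fun ⟨g, h⟩ x => ?_⟩
  induction x with
  | zero => simp
  | tmul v w => simp [extProd_apply_tmul, he, he']
  | add y z hy hz => simp only [map_add, hy, hz]

theorem extProd_swap [CommRing k] [AddCommGroup V] [Module k V] [AddCommGroup W] [Module k W]
    (ρ : Representation k G V) (τ : Representation k H W) (g : G) (h : H) (x : V ⊗[k] W) :
    TensorProduct.comm k V W (extProd ρ τ (g, h) x) =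
      extProd τ ρ (h, g) (TensorProduct.comm k V W x) := by
  induction x with
  | zero => simp
  | tmul v w => simp [extProd_apply_tmul]
  | add y z hy hz => simp only [map_add, hy, hz]

theorem RepIso.extProd_comm [CommRing k] [AddCommGroup V] [Module k V] [AddCommGroup W]
    [Module k W] [AddCommGroup V'] [Module k V'] [AddCommGroup W'] [Module k W']
    {ρ : Representation k G V} {ρ' : Representation k G V'} {τ : Representation k H W}
    {τ' : Representation k H W'} (h : RepIso (extProd ρ τ) (extProd ρ' τ')) :
    RepIso (extProd τ ρ) (extProd τ' ρ') := by
  obtain ⟨e, he⟩ := h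
  refine ⟨(TensorProduct.comm k W V).trans (e.trans (TensorProduct.comm k V' W')),
    fun ⟨g, h⟩ x => ?_⟩
  simp only [LinearEquiv.trans_apply, extProd_swap, he]

theorem RepIrreducible.repIso_of_ne_zero [CommRing k] [AddCommGroup V] [Module k V]
    [AddCommGroup W] [Module k W] {ρ : Representation k G V} {τ : Representation k G W}
    (hρ : RepIrreducible ρ) (hτ : RepIrreducible τ) (φ : V →ₗ[k] W) (hφ : φ ≠ 0)
    (h : ∀ g v, φ (ρ g v) = τ g (φ v)) : RepIso ρ τ := by
  have hker : LinearMap.ker φ = ⊥ := by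
    refine (hρ.2 _ fun g v hv => ?_).resolve_right fun ht => hφ (LinearMap.ker_eq_top.mp ht)
    rw [LinearMap.mem_ker] at hv ⊢
    rw [h, hv, map_zero]
  have hrange : LinearMap.range φ = ⊤ := by
    refine (hτ.2 _ ?_).resolve_left fun hb => hφ (LinearMap.range_eq_bot.mp hb)
    rintro g _ ⟨v, rfl⟩
    exact ⟨ρ g v, h g v⟩
  exact ⟨LinearEquiv.ofBijective φ ⟨LinearMap.ker_eq_bot.mp hker, LinearMap.range_eq_top.mp hrange⟩,
    h⟩

/-- An isomorphism of external tensor products forces the irreducible first factors to be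
isomorphic. -/
theorem RepIso.left_of_extProd [Field k] [AddCommGroup V] [Module k V] [AddCommGroup W]
    [Module k W] [AddCommGroup V'] [Module k V'] [AddCommGroup W'] [Module k W']
    {ρ : Representation k G V} {ρ' : Representation k G V'} {τ : Representation k H W}
    {τ' : Representation k H W'} (hρ : RepIrreducible ρ) (hρ' : RepIrreducible ρ')
    (hW : ∃ w : W, w ≠ 0) (h : RepIso (extProd ρ τ) (extProd ρ' τ')) : RepIso ρ ρ' := by
  obtain ⟨e, he⟩ := h
  obtain ⟨v, hv⟩ := hρ.1
  obtain ⟨w, hw⟩ := hW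
  have hvw : e (v ⊗ₜ[k] w) ≠ 0 := by
    rw [ne_eq, e.map_eq_zero_iff]
    intro h0
    obtain ⟨f, hf⟩ := Module.Projective.exists_dual_ne_zero k hw
    have := contractSnd_tmul f v w
    rw [h0, map_zero] at this
    exact smul_ne_zero hf hv this.symm
  obtain ⟨f, hf⟩ : ∃ f : W' →ₗ[k] k, contractSnd f (e (v ⊗ₜ[k] w)) ≠ 0 := by
    by_contra! hall
    exact hvw (eq_zero_of_contractSnd_eq_zero _ hall)
  refine hρ.repIso_of_ne_zero hρ'
    (contractSnd f ∘ₗ e.toLinearMap ∘ₗ (TensorProduct.mk k V W).flip w)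
    (fun h0 => hf (by simpa using LinearMap.congr_fun h0 v)) fun g u => ?_
  have hcontract : ∀ x : V' ⊗[k] W',
      contractSnd f (extProd ρ' τ' (g, 1) x) = ρ' g (contractSnd f x) := by
    intro x
    induction x with
    | zero => simp
    | tmul a b => simp [extProd_apply_tmul, contractSnd_tmul]
    | add y z hy hz => simp only [map_add, hy, hz]
  have := he (g, 1) (u ⊗ₜ[k] w)
  rw [extProd_apply_tmul, map_one, Module.End.one_apply] at this
  simp [this, hcontract]

end RepIso

section Twist

variable {n : ℕ} {F V W : Type*} [Field F] [AddCommGroup V] [Module ℂ V] [AddCommGroup W]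
  [Module ℂ W]

theorem twistGL_apply (σ : Representation ℂ (GL (Fin n) F) V) (χ : Fˣ →* ℂˣ)
    (g : GL (Fin n) F) (v : V) :
    twistGL σ χ g v = ((χ (Matrix.GeneralLinearGroup.det g) : ℂˣ) : ℂ) • σ g v := rfl

theorem twistGL_comm (σ : Representation ℂ (GL (Fin n) F) V) (χ η : Fˣ →* ℂˣ) :
    twistGL (twistGL σ χ) η = twistGL (twistGL σ η) χ := by
  ext g v
  simp only [twistGL_apply, smul_smul, mul_comm]

theorem twistGL_inv_cancel (σ : Representation ℂ (GL (Fin n) F) V) (χ : Fˣ →* ℂˣ) :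
    twistGL (twistGL σ χ⁻¹) χ = σ := by
  ext g v
  simp [twistGL_apply, smul_smul]

theorem RepIso.twistGL {σ : Representation ℂ (GL (Fin n) F) V}
    {τ : Representation ℂ (GL (Fin n) F) W} (h : RepIso σ τ) (χ : Fˣ →* ℂˣ) :
    RepIso (twistGL σ χ) (twistGL τ χ) := by
  obtain ⟨e, he⟩ := h
  exact ⟨e, fun g v => by simp only [twistGL_apply, map_smul, he]⟩

theorem repIso_twistGL_inv_iff {σ : Representation ℂ (GL (Fin n) F) V} {χ : Fˣ →* ℂˣ} :
    RepIso (twistGL σ χ⁻¹) σ ↔ RepIso (twistGL σ χ) σ := by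
  constructor <;> intro h
  · simpa only [twistGL_inv_cancel] using (h.twistGL χ).symm
  · simpa only [twistGL_comm σ χ χ⁻¹, twistGL_inv_cancel] using (h.twistGL χ⁻¹).symm

theorem RepIrreducible.twistGL {σ : Representation ℂ (GL (Fin n) F) V} (h : RepIrreducible σ)
    (χ : Fˣ →* ℂˣ) : RepIrreducible (twistGL σ χ) := by
  refine ⟨h.1, fun p hp => h.2 p fun g v hv => ?_⟩
  have := hp g v hv
  rwa [twistGL_apply, p.smul_mem_iff (Units.ne_zero _)] at this

theorem RepIso.twistGL_fixed {σ : Representation ℂ (GL (Fin n) F) V}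
    {τ : Representation ℂ (GL (Fin n) F) W} {χ η : Fˣ →* ℂˣ} (hτ : RepIso τ (_root_.twistGL σ η))
    (h : RepIso (_root_.twistGL σ χ) σ) : RepIso (_root_.twistGL τ χ) τ := by
  have h' := h.twistGL η
  rw [twistGL_comm] at h'
  exact ((hτ.twistGL χ).trans h').trans hτ.symm

end Twist

theorem statement9 {F : Type*} [Field F]
    {V₁ V₂ : Type*} [AddCommGroup V₁] [Module ℂ V₁] [AddCommGroup V₂] [Module ℂ V₂]
    (σ₁ : Representation ℂ (GL (Fin 2) F) V₁) (σ₂ : Representation ℂ (GL (Fin 2) F) V₂)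
    (h₁ : RepIrreducible σ₁) (h₂ : RepIrreducible σ₂) :
    ({χ : Fˣ →* ℂˣ | RepIso (extProd (twistGL σ₁ χ) (twistGL σ₂ χ⁻¹)) (extProd σ₁ σ₂)}
        = {χ : Fˣ →* ℂˣ | RepIso (twistGL σ₁ χ) σ₁} ∩
            {χ : Fˣ →* ℂˣ | RepIso (twistGL σ₂ χ) σ₂}) ∧
    (∀ η : Fˣ →* ℂˣ, RepIso σ₂ (twistGL σ₁ η) →
      {χ : Fˣ →* ℂˣ | RepIso (extProd (twistGL σ₁ χ) (twistGL σ₂ χ⁻¹)) (extProd σ₁ σ₂)}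
        = {χ : Fˣ →* ℂˣ | RepIso (twistGL σ₁ χ) σ₁}) := by
  have key : {χ : Fˣ →* ℂˣ | RepIso (extProd (twistGL σ₁ χ) (twistGL σ₂ χ⁻¹)) (extProd σ₁ σ₂)}
      = {χ : Fˣ →* ℂˣ | RepIso (twistGL σ₁ χ) σ₁} ∩
          {χ : Fˣ →* ℂˣ | RepIso (twistGL σ₂ χ) σ₂} := by
    ext χ
    refine ⟨fun h => ⟨?_, ?_⟩, fun h => ?_⟩
    · exact RepIso.left_of_extProd (h₁.twistGL χ) h₁ h₂.1 h
    · exact repIso_twistGL_inv_iff.mp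
        (RepIso.left_of_extProd (h₂.twistGL χ⁻¹) h₂ h₁.1 (RepIso.extProd_comm h))
    · exact RepIso.extProd_congr h.1 (repIso_twistGL_inv_iff.mpr h.2)
  refine ⟨key, fun η hη => ?_⟩
  rw [key, Set.inter_eq_left]
  exact fun χ hχ => hη.twistGL_fixed hχ

end
end
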